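/- For any u ∈ A_{Θ,λ}, the set Σ_Θ ∩ Π_{uλ} is a set of simple roots for the root system Σ_Θ ∩ Σ_{uλ} (with respect to its set of positive roots Σ⁺ ∩ Σ_Θ ∩ Σ_{uλ}). -/

import Mathlib

open scoped Classical Pointwise

noncomputable section

namespace WhittakerKL

variable {V : Type*} [AddCommGroup V] [Module ℂ V]

/-- The reflection in the root `α`, defined via the coroot functional `coroot α`
(and equal to the identity if `coroot α α ≠ 2`, which never happens for roots). -/
def sRefl (coroot : V → Module.Dual ℂ V) (α : V) : V ≃ₗ[ℂ] V :=
  if h : coroot α α = 2 then Module.reflection h else LinearEquiv.refl ℂ V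

/-- `(Σ, Σ⁺, coroot)` is the data of a reduced crystallographic root system in `V = h*`
together with a choice of positive roots, as arises from a complex semisimple Lie
algebra with a Cartan subalgebra and a fixed maximal nilpotent subalgebra. -/
structure IsRootSystem (Sg SgP : Set V) (coroot : V → Module.Dual ℂ V) : Prop where
  finite : Sg.Finite
  zero_not_mem : (0 : V) ∉ Sg
  coroot_self : ∀ α ∈ Sg, coroot α α = 2
  reflection_mem : ∀ α ∈ Sg, ∀ β ∈ Sg, sRefl coroot α β ∈ Sg
  crystallographic : ∀ α ∈ Sg, ∀ β ∈ Sg, ∃ n : ℤ, coroot α β = (n : ℂ)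
  reduced : ∀ α ∈ Sg, ∀ c : ℂ, c • α ∈ Sg → c = 1 ∨ c = -1
  pos_subset : SgP ⊆ Sg
  pos_or_neg : ∀ α ∈ Sg, (α ∈ SgP ∧ -α ∉ SgP) ∨ (α ∉ SgP ∧ -α ∈ SgP)
  pos_add : ∀ α ∈ SgP, ∀ β ∈ SgP, α + β ∈ Sg → α + β ∈ SgP

/-- The simple roots of a positive system `P`: the indecomposable elements. -/
def simples (P : Set V) : Set V := {α ∈ P | ¬ ∃ β ∈ P, ∃ γ ∈ P, α = β + γ}

/-- The set of reflections in the roots belonging to `A`. -/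
def reflSet (coroot : V → Module.Dual ℂ V) (A : Set V) : Set (V ≃ₗ[ℂ] V) :=
  {g | ∃ α ∈ A, g = sRefl coroot α}

/-- The reflection subgroup generated by the reflections in the roots of `A`. -/
def weylOf (coroot : V → Module.Dual ℂ V) (A : Set V) : Subgroup (V ≃ₗ[ℂ] V) :=
  Subgroup.closure (reflSet coroot A)

/-- The integral root subsystem `Σ_λ = {α ∈ Σ : α∨(λ) ∈ ℤ}`. -/
def integral (Sg : Set V) (coroot : V → Module.Dual ℂ V) (lam : V) : Set V :=
  {α ∈ Sg | ∃ n : ℤ, coroot α lam = (n : ℂ)}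

/-- The simple roots `Π_λ` of the integral subsystem, i.e. the simple roots of
`Σ_λ⁺ = Σ_λ ∩ Σ⁺`. -/
def PiIntegral (Sg SgP : Set V) (coroot : V → Module.Dual ℂ V) (lam : V) : Set V :=
  simples (integral Sg coroot lam ∩ SgP)

/-- `Σ_u⁺ = Σ⁺ ∩ (−u⁻¹ Σ⁺)`, the positive roots made negative by `u`. -/
def sigmaU (SgP : Set V) (u : V ≃ₗ[ℂ] V) : Set V :=
  {α ∈ SgP | -(u α) ∈ SgP}

/-- `A_λ = {u ∈ W : Σ_u⁺ ∩ Σ_λ = ∅}`. -/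
def Aset (Sg SgP : Set V) (coroot : V → Module.Dual ℂ V) (lam : V) :
    Set (V ≃ₗ[ℂ] V) :=
  {u | u ∈ weylOf coroot Sg ∧ sigmaU SgP u ∩ integral Sg coroot lam = ∅}

/-- The word length of `w` with respect to a set `S` of generators. -/
def lengthWrt (S : Set (V ≃ₗ[ℂ] V)) (w : V ≃ₗ[ℂ] V) : ℕ :=
  sInf {n | ∃ l : List (V ≃ₗ[ℂ] V), (∀ x ∈ l, x ∈ S) ∧ l.length = n ∧ l.prod = w}

/-- The reflections of the Coxeter group generated by the simple reflections `S`: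
the conjugates of elements of `S`. -/
def reflectionsWrt (S : Set (V ≃ₗ[ℂ] V)) : Set (V ≃ₗ[ℂ] V) :=
  {t | ∃ w ∈ Subgroup.closure S, ∃ s ∈ S, t = w * s * w⁻¹}

/-- The Bruhat order of the Coxeter group with simple reflections `S`: the
reflexive-transitive closure of the relation `x < x·t` for a reflection `t`
increasing the length. -/
def bruhatLE (S : Set (V ≃ₗ[ℂ] V)) : (V ≃ₗ[ℂ] V) → (V ≃ₗ[ℂ] V) → Prop :=
  Relation.ReflTransGen
    (fun x y => (∃ t ∈ reflectionsWrt S, y = x * t) ∧ lengthWrt S x < lengthWrt S y)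

/-- Strict Bruhat order. -/
def bruhatLT (S : Set (V ≃ₗ[ℂ] V)) (x y : V ≃ₗ[ℂ] V) : Prop :=
  bruhatLE S x y ∧ x ≠ y

/-- The simple reflections of `W` (w.r.t. the simple roots `Π`). -/
def Sfull (SgP : Set V) (coroot : V → Module.Dual ℂ V) : Set (V ≃ₗ[ℂ] V) :=
  reflSet coroot (simples SgP)

/-- The simple reflections of the Coxeter group `(W_λ, Π_λ)`. -/
def Sint (Sg SgP : Set V) (coroot : V → Module.Dual ℂ V) (lam : V) :
    Set (V ≃ₗ[ℂ] V) :=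
  reflSet coroot (PiIntegral Sg SgP coroot lam)

/-- The right coset `H·w`. -/
def rcoset (H : Subgroup (V ≃ₗ[ℂ] V)) (w : V ≃ₗ[ℂ] V) : Set (V ≃ₗ[ℂ] V) :=
  {x | ∃ v ∈ H, x = v * w}

/-- `C` is a right coset of `H`. -/
def isRCoset (H : Subgroup (V ≃ₗ[ℂ] V)) (C : Set (V ≃ₗ[ℂ] V)) : Prop :=
  ∃ w, C = rcoset H w

/-- The double coset `H·w·K`. -/
def dcoset (H K : Subgroup (V ≃ₗ[ℂ] V)) (w : V ≃ₗ[ℂ] V) : Set (V ≃ₗ[ℂ] V) :=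
  {x | ∃ a ∈ H, ∃ b ∈ K, x = a * w * b}

/-- `w` is the longest element of `C`, w.r.t. the Bruhat order attached to `S`. -/
def isLongest (S : Set (V ≃ₗ[ℂ] V)) (C : Set (V ≃ₗ[ℂ] V)) (w : V ≃ₗ[ℂ] V) : Prop :=
  w ∈ C ∧ ∀ x ∈ C, bruhatLE S x w

/-- `w` is the unique shortest element of `C`, w.r.t. the length function of `S`. -/
def isShortest (S : Set (V ≃ₗ[ℂ] V)) (C : Set (V ≃ₗ[ℂ] V)) (w : V ≃ₗ[ℂ] V) : Prop :=
  w ∈ C ∧ ∀ x ∈ C, x ≠ w → lengthWrt S w < lengthWrt S x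

/-- The partial order on cosets defined via longest representatives and the
Bruhat order attached to `S`. -/
def cosetLE (S : Set (V ≃ₗ[ℂ] V)) (C D : Set (V ≃ₗ[ℂ] V)) : Prop :=
  ∃ wC wD, isLongest S C wC ∧ isLongest S D wD ∧ bruhatLE S wC wD

/-- Strict version of the partial order on cosets. -/
def cosetLT (S : Set (V ≃ₗ[ℂ] V)) (C D : Set (V ≃ₗ[ℂ] V)) : Prop :=
  cosetLE S C D ∧ C ≠ D

/-- The root subsystem `Σ_Θ` generated by a subset `Θ` of simple roots:
the roots lying in the ℤ-span of `Θ`. -/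
def sigmaTheta (Sg : Set V) (Θ : Set V) : Set V :=
  {α ∈ Sg | α ∈ (Submodule.span ℤ Θ : Submodule ℤ V)}

/-- `^ΘW = {w ∈ W : w⁻¹Θ ⊆ −Σ⁺}`, the longest representatives of right `W_Θ`-cosets. -/
def thetaW (Sg SgP : Set V) (coroot : V → Module.Dual ℂ V) (Θ : Set V) :
    Set (V ≃ₗ[ℂ] V) :=
  {w | w ∈ weylOf coroot Sg ∧ ∀ α ∈ Θ, -(w⁻¹ α) ∈ SgP}

/-- `A_{Θ,λ} = A_λ ∩ (w_Θ·^ΘW)`, where `wTheta` is the longest element of `W_Θ`. -/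
def AThetaSet (Sg SgP : Set V) (coroot : V → Module.Dual ℂ V) (Θ : Set V)
    (wTheta : V ≃ₗ[ℂ] V) (lam : V) : Set (V ≃ₗ[ℂ] V) :=
  Aset Sg SgP coroot lam ∩ {x | ∃ y ∈ thetaW Sg SgP coroot Θ, x = wTheta * y}

/-- `Θ(u,λ) = u⁻¹Σ_Θ ∩ Π_λ`. -/
def ThetaUL (Sg SgP : Set V) (coroot : V → Module.Dual ℂ V) (Θ : Set V)
    (u : V ≃ₗ[ℂ] V) (lam : V) : Set V :=
  (⇑(u⁻¹) '' sigmaTheta Sg Θ) ∩ PiIntegral Sg SgP coroot lam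

/-- The relation `D ≤_{u,λ} C` on right `Hθ = W_Θ`-cosets contained in the double coset
`W_Θ u W_λ`, transported via `ind_λ` from the order (given by `cosetLE Ssub`) on right
`P = W_{λ,Θ(u,λ)}`-cosets of `Wsub = W_λ`. -/
def cosetRelLE (Hθ P : Subgroup (V ≃ₗ[ℂ] V)) (Ssub : Set (V ≃ₗ[ℂ] V))
    (u : V ≃ₗ[ℂ] V) (Wsub : Subgroup (V ≃ₗ[ℂ] V)) (D C : Set (V ≃ₗ[ℂ] V)) : Prop :=
  ∃ v' ∈ Wsub, ∃ v ∈ Wsub, D = rcoset Hθ (u * v') ∧ C = rcoset Hθ (u * v) ∧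
    cosetLE Ssub (rcoset P v') (rcoset P v)

/-- Strict version of `cosetRelLE`. -/
def cosetRelLT (Hθ P : Subgroup (V ≃ₗ[ℂ] V)) (Ssub : Set (V ≃ₗ[ℂ] V))
    (u : V ≃ₗ[ℂ] V) (Wsub : Subgroup (V ≃ₗ[ℂ] V)) (D C : Set (V ≃ₗ[ℂ] V)) : Prop :=
  cosetRelLE Hθ P Ssub u Wsub D C ∧ D ≠ C

/-- The sequence `z_0 = 1`, `z_{i+1} = z_i · s_{β_{i+1}}`. -/
def zseq (coroot : V → Module.Dual ℂ V) (βs : ℕ → V) : ℕ → (V ≃ₗ[ℂ] V)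
  | 0 => 1
  | i + 1 => zseq coroot βs i * sRefl coroot (βs i)

lemma sum_mem_span_int {E : Type*} [AddCommGroup E] {S : Set E} {A : Multiset E}
    (hA : ∀ a ∈ A, a ∈ S) : A.sum ∈ Submodule.span ℤ S :=
  multiset_sum_mem _ fun a ha ↦ Submodule.subset_span (hA a ha)

lemma exists_eq_sum_sub_sum {E : Type*} [AddCommGroup E] {S : Set E} {x : E}
    (hx : x ∈ Submodule.span ℤ S) :
    ∃ C D : Multiset E, (∀ a ∈ C, a ∈ S) ∧ (∀ a ∈ D, a ∈ S) ∧ x = C.sum - D.sum := by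
  rw [← Submodule.mem_toAddSubgroup, Submodule.span_int_eq_addSubgroupClosure] at hx
  induction hx using AddSubgroup.closure_induction with
  | mem x hx => exact ⟨{x}, 0, by simpa using hx, by simp, by simp⟩
  | zero => exact ⟨0, 0, by simp, by simp, by simp⟩
  | add x y _ _ hx hy =>
    obtain ⟨C, D, hC, hD, rfl⟩ := hx
    obtain ⟨C', D', hC', hD', rfl⟩ := hy
    exact ⟨C + C', D + D', fun a ha ↦ (Multiset.mem_add.mp ha).elim (hC a) (hC' a),
      fun a ha ↦ (Multiset.mem_add.mp ha).elim (hD a) (hD' a), by simp; abel⟩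
  | neg x _ hx =>
    obtain ⟨C, D, hC, hD, rfl⟩ := hx
    exact ⟨D, C, hD, hC, by simp⟩

lemma sRefl_apply {coroot : V → Module.Dual ℂ V} {α : V} (h : coroot α α = 2) (x : V) :
    sRefl coroot α x = x - coroot α x • α := by
  simp [sRefl, h, Module.reflection_apply]

namespace IsRootSystem

variable {Sg SgP : Set V} {coroot : V → Module.Dual ℂ V}

lemma neg_mem (hRS : IsRootSystem Sg SgP coroot) {α : V} (hα : α ∈ Sg) : -α ∈ Sg := by
  have h := hRS.reflection_mem α hα α hα
  rw [sRefl_apply (hRS.coroot_self α hα), hRS.coroot_self α hα] at h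
  convert h using 1
  module

/-- The roots, regarded as elements of their span, form a crystallographic root pairing. -/
lemma exists_rootPairing (hRS : IsRootSystem Sg SgP coroot) :
    ∃ P : RootPairing Sg ℂ (Submodule.span ℂ Sg) (Module.Dual ℂ (Submodule.span ℂ Sg)),
      P.IsCrystallographic ∧ (∀ α : Sg, (P.root α : V) = α) ∧
        ∀ (α : Sg) (x : Submodule.span ℂ Sg), P.coroot' α x = coroot α x := by
  have : Finite Sg := hRS.finite
  have : FiniteDimensional ℂ (Submodule.span ℂ Sg) := .span_of_finite ℂ hRS.finite
  have : IsAddTorsionFree V := .of_isTorsionFree ℂ V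
  have hrefl (α β : Sg) : (β : V) - coroot α β • (α : V) ∈ Sg := by
    rw [← sRefl_apply (hRS.coroot_self α α.2)]
    exact hRS.reflection_mem α α.2 β β.2
  let root : Sg ↪ Submodule.span ℂ Sg :=
    ⟨fun α ↦ ⟨α, Submodule.subset_span α.2⟩, fun α β h ↦ Subtype.ext congr($h)⟩
  have hroot_range : Set.range ((Submodule.span ℂ Sg).subtype ∘ root) = Sg :=
    Subtype.range_coe
  let corootFn (α : Sg) : Module.Dual ℂ (Submodule.span ℂ Sg) :=
    coroot α ∘ₗ (Submodule.span ℂ Sg).subtype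
  have hinj : Function.Injective corootFn := fun α β h ↦ by
    have h' (x : Sg) : coroot α x = coroot β x := congr($h (root x))
    refine Subtype.ext <| Module.eq_of_mapsTo_reflection_of_mem (f := coroot α) (g := coroot β)
      hRS.finite (hRS.coroot_self α α.2) (hRS.coroot_self β β.2) ?_ ?_ ?_ ?_ β.2
    · rw [← h', hRS.coroot_self α α.2]
    · rw [h', hRS.coroot_self β β.2]
    · exact fun x hx ↦ by simpa [Module.preReflection_apply] using hrefl α ⟨x, hx⟩
    · exact fun x hx ↦ by simpa [Module.preReflection_apply] using hrefl β ⟨x, hx⟩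
  let P := RootPairing.mk'' (Module.Dual.eval ℂ (Submodule.span ℂ Sg)) root ⟨corootFn, hinj⟩
    (fun α ↦ hRS.coroot_self α α.2)
    (by
      rintro α - ⟨β, rfl⟩
      exact ⟨⟨_, hrefl α β⟩, rfl⟩)
    (by
      rw [← Submodule.map_injective_of_injective (Submodule.span ℂ Sg).injective_subtype |>.eq_iff,
        Submodule.map_span, ← Set.range_comp, hroot_range, Submodule.map_top,
        Submodule.range_subtype])
  refine ⟨P, ⟨fun α β ↦ ?_⟩, fun α ↦ rfl, fun α x ↦ rfl⟩
  obtain ⟨n, hn⟩ := hRS.crystallographic β β.2 α α.2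
  exact ⟨n, hn.symm⟩

/-- The invariant form `∑ α, α∨(x) α∨(y)`, together with its sign properties. -/
lemma exists_form (hRS : IsRootSystem Sg SgP coroot) :
    ∃ B : V →+ V →+ ℝ, (∀ x y, B x y = B y x) ∧ (∀ α ∈ Sg, 0 < B α α) ∧
      (∀ x ∈ Submodule.span ℤ Sg, 0 ≤ B x x ∧ (B x x = 0 → ∀ y, B y x = 0)) ∧
      ∀ α ∈ Sg, ∀ β ∈ Sg, B α β < 0 → α + β = 0 ∨ α + β ∈ Sg := by
  have : Fintype Sg := hRS.finite.fintype
  obtain ⟨P, hP, hroot, hcoroot⟩ := hRS.exists_rootPairing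
  let B : V →+ V →+ ℝ := .mk'
    (fun x ↦ .mk' (fun y ↦ (∑ α : Sg, coroot α x * coroot α y).re) fun y z ↦ by
      simp only [map_add, mul_add, Finset.sum_add_distrib, Complex.add_re])
    fun x y ↦ by
      ext z
      simp only [map_add, add_mul, Finset.sum_add_distrib, Complex.add_re, AddMonoidHom.mk'_apply,
        AddMonoidHom.add_apply]
  have hB (x y : V) : B x y = (∑ α : Sg, coroot α x * coroot α y).re := rfl
  have hint (x : V) (hx : x ∈ Submodule.span ℤ Sg) (α : Sg) : ∃ n : ℤ, coroot α x = n := by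
    induction hx using Submodule.span_induction with
    | mem x hx => exact hRS.crystallographic α α.2 x hx
    | zero => exact ⟨0, by simp⟩
    | add x y _ _ hx hy =>
      obtain ⟨⟨m, hm⟩, ⟨n, hn⟩⟩ := hx, hy
      exact ⟨m + n, by simp [hm, hn]⟩
    | smul k x _ hx =>
      obtain ⟨m, hm⟩ := hx
      exact ⟨k * m, by simp [hm]⟩
  have hsq (x : V) (hx : x ∈ Submodule.span ℤ Sg) :
      ∃ n : Sg → ℤ, (∀ α : Sg, coroot α x = n α) ∧ B x x = ∑ α, (n α : ℝ) * n α := by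
    choose n hn using hint x hx
    refine ⟨n, hn, ?_⟩
    simp [hB, hn]
  have hpos (α : V) (hα : α ∈ Sg) : 0 < B α α := by
    obtain ⟨n, hn, hn'⟩ := hsq α (Submodule.subset_span hα)
    rw [hn']
    refine Finset.sum_pos' (fun _ _ ↦ mul_self_nonneg _) ⟨⟨α, hα⟩, Finset.mem_univ _, ?_⟩
    have h2 : n ⟨α, hα⟩ = 2 := by exact_mod_cast (hn ⟨α, hα⟩).symm.trans (hRS.coroot_self α hα)
    norm_num [h2]
  refine ⟨B, fun x y ↦ by simp only [hB, mul_comm], hpos, fun x hx ↦ ?_, fun α hα β hβ h ↦ ?_⟩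
  · obtain ⟨n, hn, hn'⟩ := hsq x hx
    refine ⟨hn' ▸ Finset.sum_nonneg fun _ _ ↦ mul_self_nonneg _, fun h0 y ↦ ?_⟩
    rw [hn', Finset.sum_eq_zero_iff_of_nonneg fun _ _ ↦ mul_self_nonneg _] at h0
    have h0' (α : Sg) : coroot α x = 0 := by simpa [hn] using h0 α (Finset.mem_univ α)
    simp [hB, h0']
  · have hform (i j : Sg) : B i j = (P.RootForm (P.root i) (P.root j)).re := by
      simp [hB, RootPairing.rootForm_apply_apply, hcoroot, hroot]
    let i : Sg := ⟨α, hα⟩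
    let j : Sg := ⟨β, hβ⟩
    have key : 2 * B α β = P.pairingIn ℤ i j * B β β := by
      have := congr(($(P.toInvariantForm.two_mul_apply_root_root i j)).re)
      rw [← P.algebraMap_pairingIn ℤ] at this
      simpa [← hform i j, ← hform j j] using this
    have hneg : P.pairingIn ℤ i j < 0 := by
      by_contra! h'
      have : (0 : ℝ) ≤ P.pairingIn ℤ i j := by exact_mod_cast h'
      nlinarith [hpos β hβ]
    by_cases h0 : P.root i = -P.root j
    · left
      simpa [hroot, i, j] using congr((($h0 + P.root j : Submodule.span ℂ Sg) : V))
    · right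
      obtain ⟨k, hk⟩ := P.root_add_root_mem_of_pairingIn_neg hneg h0
      have : (k : V) = α + β := by simpa [hroot, i, j] using congr(($hk : V))
      exact this ▸ k.2

/-- A nonempty sum of positive roots is not in the radical of the invariant form. -/
lemma exists_form_sum_ne_zero (hRS : IsRootSystem Sg SgP coroot) {B : V →+ V →+ ℝ}
    (hpos : ∀ α ∈ Sg, 0 < B α α)
    (hadd : ∀ α ∈ Sg, ∀ β ∈ Sg, B α β < 0 → α + β = 0 ∨ α + β ∈ Sg)
    {A : Multiset V} (hA : ∀ α ∈ A, α ∈ SgP) (hA0 : A ≠ 0) : ∃ x, B x A.sum ≠ 0 := by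
  induction h : A.card using Nat.strong_induction_on generalizing A with
  | _ n ih =>
  by_contra! hsum
  obtain ⟨α, hα⟩ := Multiset.exists_mem_of_ne_zero hA0
  obtain ⟨A, rfl⟩ := Multiset.exists_cons_of_mem hα
  have hαP := hA α hα
  have hαS := hRS.pos_subset hαP
  obtain ⟨β, hβ, hαβ⟩ : ∃ β ∈ A, B α β < 0 := by
    by_contra! hcon
    have h1 : 0 ≤ B α A.sum := by
      rw [map_multiset_sum]
      exact Multiset.sum_nonneg (by simpa using hcon)
    have h2 := hsum α
    rw [Multiset.sum_cons, map_add] at h2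
    linarith [hpos α hαS]
  obtain ⟨A, rfl⟩ := Multiset.exists_cons_of_mem hβ
  have hβP : β ∈ SgP := hA β (by simp)
  have hαβP : α + β ∈ SgP := by
    rcases hadd α hαS β (hRS.pos_subset hβP) hαβ with h0 | h0
    · obtain rfl := eq_neg_of_add_eq_zero_right h0
      rcases hRS.pos_or_neg α hαS with h' | h'
      · exact absurd hβP h'.2
      · exact absurd hαP h'.1
    · exact hRS.pos_add α hαP β hβP h0
  obtain ⟨x, hx⟩ := ih ((α + β) ::ₘ A).card (by simp [← h]) (A := (α + β) ::ₘ A)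
    (fun γ hγ ↦ (Multiset.mem_cons.mp hγ).elim (· ▸ hαβP) fun hγ ↦ hA γ (by simp [hγ]))
    (by simp) rfl
  exact hx (by simpa [add_assoc] using hsum x)

/-- A nonempty sum of positive roots is nonzero. -/
lemma sum_ne_zero (hRS : IsRootSystem Sg SgP coroot) {A : Multiset V} (hA : ∀ α ∈ A, α ∈ SgP)
    (hA0 : A ≠ 0) : A.sum ≠ 0 := by
  obtain ⟨B, -, hpos, -, hadd⟩ := hRS.exists_form
  obtain ⟨x, hx⟩ := hRS.exists_form_sum_ne_zero hpos hadd hA hA0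
  exact fun h ↦ hx (by simp [h])

/-- Every positive root is a sum of simple roots. -/
lemma exists_sum_simples (hRS : IsRootSystem Sg SgP coroot) {α : V} (hα : α ∈ SgP) :
    ∃ A : Multiset V, (∀ β ∈ A, β ∈ simples SgP) ∧ A.sum = α := by
  have : Finite SgP := hRS.finite.subset hRS.pos_subset
  let r (γ β : SgP) : Prop :=
    ∃ A : Multiset V, (∀ δ ∈ A, δ ∈ SgP) ∧ A ≠ 0 ∧ (β : V) = γ + A.sum
  have : IsTrans SgP r := ⟨by
    rintro x y z ⟨A, hA, hA0, h⟩ ⟨A', hA', -, h'⟩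
    refine ⟨A + A', fun δ hδ ↦ ?_, by simp [hA0], by rw [h', h, Multiset.sum_add, add_assoc]⟩
    exact (Multiset.mem_add.mp hδ).elim (hA δ) (hA' δ)⟩
  have : Std.Irrefl r := ⟨by
    rintro x ⟨A, hA, hA0, h⟩
    exact hRS.sum_ne_zero hA hA0 (by simpa using h)⟩
  have hwf : WellFounded r := Finite.wellFounded_of_trans_of_irrefl r
  suffices ∀ x : SgP, ∃ A : Multiset V, (∀ β ∈ A, β ∈ simples SgP) ∧ A.sum = x from
    this ⟨α, hα⟩
  intro x
  induction x using hwf.induction with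
  | _ x ih =>
  by_cases hx : (x : V) ∈ simples SgP
  · exact ⟨{(x : V)}, by simpa using hx, by simp⟩
  obtain ⟨β, hβ, γ, hγ, h⟩ : ∃ β ∈ SgP, ∃ γ ∈ SgP, (x : V) = β + γ := by
    by_contra hcon
    exact hx ⟨x.2, hcon⟩
  obtain ⟨A, hA, hAs⟩ := ih ⟨β, hβ⟩ ⟨{γ}, by simpa using hγ, by simp, by simpa using h⟩
  obtain ⟨A', hA', hAs'⟩ :=
    ih ⟨γ, hγ⟩ ⟨{β}, by simpa using hβ, by simp, by simpa [add_comm] using h⟩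
  refine ⟨A + A', fun δ hδ ↦ ?_, by rw [Multiset.sum_add, hAs, hAs', h]⟩
  exact (Multiset.mem_add.mp hδ).elim (hA δ) (hA' δ)

lemma sub_notMem_of_mem_simples (hRS : IsRootSystem Sg SgP coroot) {α β : V}
    (hα : α ∈ simples SgP) (hβ : β ∈ simples SgP) : α - β ∉ Sg := by
  intro h
  rcases hRS.pos_or_neg _ h with h | h
  · exact hα.2 ⟨α - β, h.1, β, hβ.1, by abel⟩
  · exact hβ.2 ⟨-(α - β), h.2, α, hα.1, by abel⟩

/-- A sum of simple roots determines their multiplicities. -/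
lemma multiset_eq_of_sum_eq (hRS : IsRootSystem Sg SgP coroot) {A C : Multiset V}
    (hA : ∀ α ∈ A, α ∈ simples SgP) (hC : ∀ α ∈ C, α ∈ simples SgP) (h : A.sum = C.sum) :
    A = C := by
  obtain ⟨B, hsymm, hpos, hsemi, hadd⟩ := hRS.exists_form
  have hobtuse (α β : V) (hα : α ∈ simples SgP) (hβ : β ∈ simples SgP) (hne : α ≠ β) :
      B α β ≤ 0 := by
    by_contra! hcon
    rcases hadd α (hRS.pos_subset hα.1) (-β) (hRS.neg_mem (hRS.pos_subset hβ.1))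
      (by simpa using hcon) with h | h
    · exact hne (by simpa [← sub_eq_add_neg, sub_eq_zero] using h)
    · exact hRS.sub_notMem_of_mem_simples hα hβ (sub_eq_add_neg α β ▸ h)
  have hD : ∀ α ∈ A - C, α ∈ simples SgP := fun α hα ↦ hA α (Multiset.mem_of_le tsub_le_self hα)
  have hE : ∀ α ∈ C - A, α ∈ simples SgP := fun α hα ↦ hC α (Multiset.mem_of_le tsub_le_self hα)
  have hsum : (A - C).sum = (C - A).sum := by
    have h1 : A - C + C = C - A + A := by
      ext α
      simp only [Multiset.count_add, Multiset.count_sub]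
      omega
    simpa [h] using congr(($h1).sum)
  have hdisj (α : V) (hα : α ∈ A - C) (hα' : α ∈ C - A) : False := by
    rw [← Multiset.count_pos, Multiset.count_sub] at hα hα'
    omega
  have hrad : ∀ x, B x (A - C).sum = 0 := by
    obtain ⟨h0, h1⟩ := hsemi _ (sum_mem_span_int fun α hα ↦ hRS.pos_subset (hD α hα).1)
    refine h1 (le_antisymm ?_ h0)
    nth_rw 1 [hsum]
    rw [map_multiset_sum]
    refine (Multiset.sum_le_card_nsmul _ 0 fun r hr ↦ ?_).trans_eq (smul_zero _)
    obtain ⟨α, hα, rfl⟩ := Multiset.mem_map.mp hr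
    rw [hsymm, map_multiset_sum]
    refine (Multiset.sum_le_card_nsmul _ 0 fun r hr ↦ ?_).trans_eq (smul_zero _)
    obtain ⟨β, hβ, rfl⟩ := Multiset.mem_map.mp hr
    exact hobtuse α β (hD α hα) (hE β hβ) fun h ↦ hdisj α hα (h ▸ hβ)
  have hzero (D : Multiset V) (hD : ∀ α ∈ D, α ∈ simples SgP) (h : D.sum = (A - C).sum) :
      D = 0 := by
    by_contra h0
    obtain ⟨x, hx⟩ := hRS.exists_form_sum_ne_zero hpos hadd (fun α hα ↦ (hD α hα).1) h0
    exact hx (h ▸ hrad x)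
  exact le_antisymm (tsub_eq_zero_iff_le.mp (hzero _ hD rfl))
    (tsub_eq_zero_iff_le.mp (hzero _ hE hsum.symm))

/-- If a sum of two positive roots lies in the span of a set of simple roots, so does each
summand. -/
lemma mem_span_of_add_mem_span (hRS : IsRootSystem Sg SgP coroot) {Θ : Set V}
    (hΘ : Θ ⊆ simples SgP) {β γ : V} (hβ : β ∈ SgP) (hγ : γ ∈ SgP)
    (h : β + γ ∈ Submodule.span ℤ Θ) : β ∈ Submodule.span ℤ Θ := by
  obtain ⟨A, hA, rfl⟩ := hRS.exists_sum_simples hβ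
  obtain ⟨A', hA', rfl⟩ := hRS.exists_sum_simples hγ
  obtain ⟨C, D, hC, hD, hCD⟩ := exists_eq_sum_sub_sum h
  have hAC : A + A' + D = C := hRS.multiset_eq_of_sum_eq
    (by
      simp only [Multiset.mem_add]
      rintro α ((hα | hα) | hα)
      exacts [hA α hα, hA' α hα, hΘ (hD α hα)])
    (fun α hα ↦ hΘ (hC α hα)) (by simp [hCD])
  exact sum_mem_span_int fun α hα ↦ hC α (hAC ▸ by simp [hα])

end IsRootSystem

/-- For `u ∈ A_{Θ,λ}`, the set `Σ_Θ ∩ Π_{uλ}` is a set of simple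
roots for the root system `Σ_Θ ∩ Σ_{uλ}` with respect to its positive roots
`Σ⁺ ∩ Σ_Θ ∩ Σ_{uλ}`. -/
theorem sigmaTheta_inter_PiIntegral_simples
    (Sg SgP : Set V) (coroot : V → Module.Dual ℂ V)
    (hRS : IsRootSystem Sg SgP coroot) (lam : V)
    (Θ : Set V) (hΘ : Θ ⊆ simples SgP)
    (wTheta : V ≃ₗ[ℂ] V)
    (hwTheta : wTheta ∈ weylOf coroot Θ ∧ ∀ x ∈ weylOf coroot Θ,
      lengthWrt (Sfull SgP coroot) x ≤ lengthWrt (Sfull SgP coroot) wTheta)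
    (u : V ≃ₗ[ℂ] V) (hu : u ∈ AThetaSet Sg SgP coroot Θ wTheta lam) :
    sigmaTheta Sg Θ ∩ PiIntegral Sg SgP coroot (u lam)
      = simples (SgP ∩ sigmaTheta Sg Θ ∩ integral Sg coroot (u lam)) := by
  ext α
  constructor
  · rintro ⟨hαΘ, ⟨hαl, hαP⟩, hα⟩
    refine ⟨⟨⟨hαP, hαΘ⟩, hαl⟩, ?_⟩
    rintro ⟨β, ⟨⟨hβP, -⟩, hβl⟩, γ, ⟨⟨hγP, -⟩, hγl⟩, rfl⟩
    exact hα ⟨β, ⟨hβl, hβP⟩, γ, ⟨hγl, hγP⟩, rfl⟩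
  · rintro ⟨⟨⟨hαP, hαΘ⟩, hαl⟩, hα⟩
    refine ⟨hαΘ, ⟨hαl, hαP⟩, ?_⟩
    rintro ⟨β, ⟨hβl, hβP⟩, γ, ⟨hγl, hγP⟩, rfl⟩
    have hβ := hRS.mem_span_of_add_mem_span hΘ hβP hγP hαΘ.2
    have hγ := hRS.mem_span_of_add_mem_span hΘ hγP hβP (add_comm β γ ▸ hαΘ.2)
    exact hα ⟨β, ⟨⟨hβP, hRS.pos_subset hβP, hβ⟩, hβl⟩, γ, ⟨⟨hγP, hRS.pos_subset hγP, hγ⟩, hγl⟩,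
      rfl⟩

end WhittakerKL
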